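/- arXiv:2411.05097 — 2 statements merged into one kernel-verified Lean document; each statement's English description precedes it below -/
import Mathlib

section
/- Let k ≥ 2 and let X, Y, Z be clusters of the k-clustering A^k produced by an execution of average-link on a finite metric space, with Y ≠ Z. Then diam(X) ≤ 2 · H_{|X|−1} · avg(Y,Z). -/
open Finset

/-- Average distance between two finite sets of points. -/
noncomputable def avgD {X : Type*} (d : X → X → ℝ) (A B : Finset X) : ℝ :=
  (∑ a ∈ A, ∑ b ∈ B, d a b) / ((A.card : ℝ) * (B.card : ℝ))

/-- The diameter of a finite set: `diam(C) = max_{x,y ∈ C} d x y` (and `0` for empty or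
singleton `C`, since `sSup ∅ = 0` in `ℝ` and `d x x = 0`). -/
noncomputable def diamF {X : Type*} (d : X → X → ℝ) (C : Finset X) : ℝ :=
  sSup {r : ℝ | ∃ x ∈ C, ∃ y ∈ C, r = d x y}

/-- The `p`-th harmonic number `H_p = Σ_{i=1}^p 1/i` (with `H_0 = 0`). -/
noncomputable def harmonicR (p : ℕ) : ℝ := ∑ i ∈ Finset.range p, (1 : ℝ) / (i + 1)

/-- An execution of average-link. -/
structure AvgLinkExec (X : Type*) [Fintype X] [DecidableEq X] (d : X → X → ℝ) where
  part : ℕ → Finset (Finset X)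
  init : part (Fintype.card X) = Finset.univ.image (fun x : X => ({x} : Finset X))
  merge : ∀ k : ℕ, 1 ≤ k → k < Fintype.card X →
    ∃ A ∈ part (k + 1), ∃ B ∈ part (k + 1), A ≠ B ∧
      (∀ A' ∈ part (k + 1), ∀ B' ∈ part (k + 1), A' ≠ B' → avgD d A B ≤ avgD d A' B') ∧
      part k = insert (A ∪ B) (((part (k + 1)).erase A).erase B)

theorem harmonicR_mono {p q : ℕ} (h : p ≤ q) : harmonicR p ≤ harmonicR q := by
  unfold harmonicR
  exact Finset.sum_le_sum_of_subset_of_nonneg (Finset.range_mono h)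
    (fun i _ _ => by positivity)

theorem harmonicR_nonneg (p : ℕ) : 0 ≤ harmonicR p :=
  Finset.sum_nonneg fun i _ => by positivity

theorem one_le_harmonicR {p : ℕ} (hp : 1 ≤ p) : 1 ≤ harmonicR p := by
  have h := harmonicR_mono hp
  simpa [harmonicR] using h

theorem le_mul_harmonicR_add_sub (a b : ℕ) :
    (b : ℝ) ≤ ((a : ℝ) + b) * (harmonicR (a + b) - harmonicR a) := by
  rcases Nat.eq_zero_or_pos b with rfl | hb
  · simp
  have hpos : (0 : ℝ) < (a : ℝ) + b := by positivity
  have h : ∑ _i ∈ Finset.range b, 1 / ((a : ℝ) + b) ≤ harmonicR (a + b) - harmonicR a := by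
    unfold harmonicR
    rw [Finset.sum_range_add, add_sub_cancel_left]
    refine Finset.sum_le_sum fun i hi => ?_
    have hib : (i : ℝ) + 1 ≤ b := by exact_mod_cast Finset.mem_range.mp hi
    push_cast
    exact one_div_le_one_div_of_le (by positivity) (by linarith)
  rw [Finset.sum_const, Finset.card_range, nsmul_eq_mul, mul_one_div, div_le_iff₀ hpos] at h
  linarith

theorem avgD_dist_nonneg {X : Type*} [MetricSpace X] (A B : Finset X) : 0 ≤ avgD dist A B :=
  div_nonneg (Finset.sum_nonneg fun _ _ => Finset.sum_nonneg fun _ _ => dist_nonneg)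
    (by positivity)

theorem avgD_dist_comm {X : Type*} [MetricSpace X] (A B : Finset X) :
    avgD dist A B = avgD dist B A := by
  unfold avgD
  rw [Finset.sum_comm, mul_comm (A.card : ℝ)]
  simp only [dist_comm]

theorem le_avgD_iff {X : Type*} {d : X → X → ℝ} {A B : Finset X} (hA : A.Nonempty)
    (hB : B.Nonempty) {δ : ℝ} :
    δ ≤ avgD d A B ↔ δ * (A.card * B.card) ≤ ∑ a ∈ A, ∑ b ∈ B, d a b := by
  have := hA.card_pos
  have := hB.card_pos
  exact le_div_iff₀ (by positivity)

theorem avgD_le_iff {X : Type*} {d : X → X → ℝ} {A B : Finset X} (hA : A.Nonempty)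
    (hB : B.Nonempty) {δ : ℝ} :
    avgD d A B ≤ δ ↔ ∑ a ∈ A, ∑ b ∈ B, d a b ≤ δ * (A.card * B.card) := by
  have := hA.card_pos
  have := hB.card_pos
  exact div_le_iff₀ (by positivity)

theorem le_avgD_union {X : Type*} [DecidableEq X] {d : X → X → ℝ} {A B C : Finset X}
    (hA : A.Nonempty) (hB : B.Nonempty) (hC : C.Nonempty) (hAB : Disjoint A B) {δ : ℝ}
    (hAC : δ ≤ avgD d A C) (hBC : δ ≤ avgD d B C) : δ ≤ avgD d (A ∪ B) C := by
  rw [le_avgD_iff hA hC] at hAC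
  rw [le_avgD_iff hB hC] at hBC
  rw [le_avgD_iff (hA.mono Finset.subset_union_left) hC, Finset.sum_union hAB,
    Finset.card_union_of_disjoint hAB]
  push_cast
  linarith

/-- The bounds on `C` that follow when `C` is built by successive merges whose average
distances are at most `δ`. -/
structure LinkBounded {X : Type*} [MetricSpace X] (δ : ℝ) (C : Finset X) : Prop where
  sum_le : ∀ x ∈ C, ∑ y ∈ C, dist x y ≤ (harmonicR C.card - 1) * C.card * δ
  dist_le : ∀ x ∈ C, ∀ y ∈ C, dist x y ≤ 2 * harmonicR (C.card - 1) * δ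

theorem LinkBounded.singleton {X : Type*} [MetricSpace X] (δ : ℝ) (x : X) :
    LinkBounded δ ({x} : Finset X) := by
  constructor <;> simp [harmonicR]

theorem LinkBounded.mono {X : Type*} [MetricSpace X] {δ ε : ℝ} {C : Finset X}
    (h : LinkBounded δ C) (hδ : δ ≤ ε) : LinkBounded ε C where
  sum_le x hx := by
    have := one_le_harmonicR (Finset.card_pos.mpr ⟨x, hx⟩)
    exact (h.sum_le x hx).trans
      (mul_le_mul_of_nonneg_left hδ (mul_nonneg (by linarith) (by positivity)))
  dist_le x hx y hy := by
    have := harmonicR_nonneg (C.card - 1)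
    exact (h.dist_le x hx y hy).trans (mul_le_mul_of_nonneg_left hδ (by positivity))

section Union

variable {X : Type*} [MetricSpace X] {δ : ℝ} {A B : Finset X}

theorem LinkBounded.sum_dist_le (hA : LinkBounded δ A) (hB : B.Nonempty)
    (hAB : avgD dist A B ≤ δ) {x : X} (hx : x ∈ A) :
    ∑ b ∈ B, dist x b ≤ harmonicR A.card * B.card * δ := by
  have hApos : (0 : ℝ) < A.card := by exact_mod_cast Finset.card_pos.mpr ⟨x, hx⟩
  rw [avgD_le_iff ⟨x, hx⟩ hB] at hAB
  have tri : ∑ b ∈ B, ∑ _a ∈ A, dist x b ≤ ∑ b ∈ B, ∑ a ∈ A, (dist x a + dist a b) :=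
    Finset.sum_le_sum fun b _ => Finset.sum_le_sum fun a _ => dist_triangle x a b
  simp only [Finset.sum_add_distrib, Finset.sum_const, nsmul_eq_mul, ← Finset.mul_sum] at tri
  rw [Finset.sum_comm (s := B)] at tri
  have hB0 : (0 : ℝ) ≤ B.card := by positivity
  have hS := mul_le_mul_of_nonneg_left (hA.sum_le x hx) hB0
  refine le_of_mul_le_mul_left ?_ hApos
  linarith

theorem LinkBounded.dist_le_add (hA : LinkBounded δ A) (hB : LinkBounded δ B)
    (hAB : avgD dist A B ≤ δ) {x y : X} (hx : x ∈ A) (hy : y ∈ B) :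
    dist x y ≤ (harmonicR A.card + harmonicR B.card - 1) * δ := by
  have hBpos : (0 : ℝ) < B.card := by exact_mod_cast Finset.card_pos.mpr ⟨y, hy⟩
  have tri : ∑ _b ∈ B, dist x y ≤ ∑ b ∈ B, (dist x b + dist y b) :=
    Finset.sum_le_sum fun b _ => dist_triangle_right x y b
  simp only [Finset.sum_add_distrib, Finset.sum_const, nsmul_eq_mul] at tri
  have h₁ := hA.sum_dist_le ⟨y, hy⟩ hAB hx
  have h₂ := hB.sum_le y hy
  refine le_of_mul_le_mul_left ?_ hBpos
  linarith

variable [DecidableEq X]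

theorem LinkBounded.sum_union_le (hA : LinkBounded δ A) (hB : B.Nonempty) (hδ : 0 ≤ δ)
    (hdisj : Disjoint A B) (hAB : avgD dist A B ≤ δ) {x : X} (hx : x ∈ A) :
    ∑ y ∈ A ∪ B, dist x y ≤ (harmonicR (A ∪ B).card - 1) * (A ∪ B).card * δ := by
  rw [Finset.sum_union hdisj, Finset.card_union_of_disjoint hdisj]
  have h₁ := hA.sum_le x hx
  have h₂ := hA.sum_dist_le hB hAB hx
  have h₃ := mul_le_mul_of_nonneg_right (le_mul_harmonicR_add_sub A.card B.card) hδ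
  push_cast
  linarith

theorem LinkBounded.dist_le_union (hA : LinkBounded δ A) (hB : LinkBounded δ B)
    (hBne : B.Nonempty) (hδ : 0 ≤ δ) (hdisj : Disjoint A B) (hAB : avgD dist A B ≤ δ) {x y : X}
    (hx : x ∈ A) (hy : y ∈ A ∪ B) : dist x y ≤ 2 * harmonicR ((A ∪ B).card - 1) * δ := by
  rw [Finset.card_union_of_disjoint hdisj]
  have hApos : 0 < A.card := Finset.card_pos.mpr ⟨x, hx⟩
  have hBpos := hBne.card_pos
  rcases Finset.mem_union.mp hy with hy | hy
  · refine (hA.dist_le x hx y hy).trans (mul_le_mul_of_nonneg_right ?_ hδ)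
    have := harmonicR_mono (show A.card - 1 ≤ A.card + B.card - 1 by omega)
    linarith
  · refine (hA.dist_le_add hB hAB hx hy).trans (mul_le_mul_of_nonneg_right ?_ hδ)
    have := harmonicR_mono (show A.card ≤ A.card + B.card - 1 by omega)
    have := harmonicR_mono (show B.card ≤ A.card + B.card - 1 by omega)
    linarith

theorem LinkBounded.union (hA : LinkBounded δ A) (hB : LinkBounded δ B) (hAne : A.Nonempty)
    (hBne : B.Nonempty) (hδ : 0 ≤ δ) (hdisj : Disjoint A B) (hAB : avgD dist A B ≤ δ) :
    LinkBounded δ (A ∪ B) := by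
  have hBA : avgD dist B A ≤ δ := avgD_dist_comm A B ▸ hAB
  constructor
  · intro x hx
    rcases Finset.mem_union.mp hx with hx | hx
    · exact hA.sum_union_le hBne hδ hdisj hAB hx
    · rw [Finset.union_comm]
      exact hB.sum_union_le hAne hδ hdisj.symm hBA hx
  · intro x hx y hy
    rcases Finset.mem_union.mp hx with hx | hx
    · exact hA.dist_le_union hB hBne hδ hdisj hAB hx hy
    · rw [Finset.union_comm] at hy ⊢
      exact hB.dist_le_union hA hAne hδ hdisj.symm hBA hx hy

end Union

/-- The properties of the clusterings of an average-link execution preserved by merging. -/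
structure LinkClustering {X : Type*} [MetricSpace X] (P : Finset (Finset X)) : Prop where
  nonempty : ∀ C ∈ P, C.Nonempty
  disjoint : ∀ A ∈ P, ∀ B ∈ P, A ≠ B → Disjoint A B
  bounded : ∀ C ∈ P, ∀ A ∈ P, ∀ B ∈ P, A ≠ B → LinkBounded (avgD dist A B) C

theorem LinkClustering.singletons (X : Type*) [MetricSpace X] [Fintype X] [DecidableEq X] :
    LinkClustering (Finset.univ.image (fun x : X => ({x} : Finset X))) where
  nonempty := by simp
  disjoint := by
    simp only [Finset.mem_image, Finset.mem_univ, true_and, forall_exists_index,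
      forall_apply_eq_imp_iff]
    intro x y hxy
    rw [Finset.disjoint_singleton]
    rintro rfl
    exact hxy rfl
  bounded := by
    simp only [Finset.mem_image, Finset.mem_univ, true_and, forall_exists_index,
      forall_apply_eq_imp_iff]
    exact fun x _ _ _ => LinkBounded.singleton _ x

theorem LinkClustering.merge {X : Type*} [MetricSpace X] [DecidableEq X]
    {P : Finset (Finset X)} (hP : LinkClustering P) {A B : Finset X} (hA : A ∈ P) (hB : B ∈ P)
    (hne : A ≠ B)
    (hmin : ∀ A' ∈ P, ∀ B' ∈ P, A' ≠ B' → avgD dist A B ≤ avgD dist A' B') :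
    LinkClustering (insert (A ∪ B) ((P.erase A).erase B)) := by
  have hAne := hP.nonempty A hA
  have hBne := hP.nonempty B hB
  have hdisj := hP.disjoint A hA B hB hne
  have mem_cases : ∀ C ∈ insert (A ∪ B) ((P.erase A).erase B),
      C = A ∪ B ∨ (C ∈ P ∧ A ≠ C ∧ B ≠ C) := by
    intro C hC
    simp only [Finset.mem_insert, Finset.mem_erase] at hC
    tauto
  have hunion : ∀ C, C ∈ P ∧ A ≠ C ∧ B ≠ C → avgD dist A B ≤ avgD dist (A ∪ B) C :=
    fun C ⟨hC, hAC, hBC⟩ => le_avgD_union hAne hBne (hP.nonempty C hC) hdisj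
      (hmin A hA C hC hAC) (hmin B hB C hC hBC)
  have hunion_disj : ∀ C, C ∈ P ∧ A ≠ C ∧ B ≠ C → Disjoint (A ∪ B) C :=
    fun C ⟨hC, hAC, hBC⟩ => Finset.disjoint_union_left.mpr
      ⟨hP.disjoint A hA C hC hAC, hP.disjoint B hB C hC hBC⟩
  refine ⟨fun C hC => ?_, fun C hC D hD hCD => ?_, fun C hC D hD F hF hDF => ?_⟩
  · rcases mem_cases C hC with rfl | h
    · exact hAne.mono Finset.subset_union_left
    · exact hP.nonempty C h.1
  · rcases mem_cases C hC with rfl | h <;> rcases mem_cases D hD with rfl | h'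
    · exact absurd rfl hCD
    · exact hunion_disj D h'
    · exact (hunion_disj C h).symm
    · exact hP.disjoint C h.1 D h'.1 hCD
  · have hle : avgD dist A B ≤ avgD dist D F := by
      rcases mem_cases D hD with rfl | h <;> rcases mem_cases F hF with rfl | h'
      · exact absurd rfl hDF
      · exact hunion F h'
      · exact avgD_dist_comm (A ∪ B) D ▸ hunion D h
      · exact hmin D h.1 F h'.1 hDF
    refine LinkBounded.mono ?_ hle
    rcases mem_cases C hC with rfl | h
    · exact (hP.bounded A hA A hA B hB hne).union (hP.bounded B hB A hA B hB hne) hAne hBne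
        (avgD_dist_nonneg A B) hdisj le_rfl
    · exact hP.bounded C h.1 A hA B hB hne

theorem AvgLinkExec.linkClustering {X : Type*} [MetricSpace X] [Fintype X] [DecidableEq X]
    (E : AvgLinkExec X dist) {k : ℕ} (hk : 1 ≤ k) (hkn : k ≤ Fintype.card X) :
    LinkClustering (E.part k) := by
  refine Nat.decreasingInduction' (P := fun j => LinkClustering (E.part j))
    (fun j hj hkj ih => ?_) hkn (E.init ▸ LinkClustering.singletons X)
  obtain ⟨A, hA, B, hB, hne, hmin, heq⟩ := E.merge j (hk.trans hkj) hj
  exact heq ▸ ih.merge hA hB hne hmin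

/-- Let `k ≥ 2` and let `Xc`, `Y`, `Z` be clusters of the `k`-clustering `A^k` produced by
average-link on a finite metric space, with `Y ≠ Z`. Then
`diam(Xc) ≤ 2 · H_{|Xc|−1} · avg(Y,Z)`. -/
theorem avgLink_diam_le_two_harmonic_avg {X : Type*} [MetricSpace X] [Fintype X] [DecidableEq X]
    (E : AvgLinkExec X dist) (k : ℕ) (hk2 : 2 ≤ k) (hkn : k ≤ Fintype.card X)
    (Xc Y Z : Finset X) (hXc : Xc ∈ E.part k) (hY : Y ∈ E.part k) (hZ : Z ∈ E.part k)
    (hYZ : Y ≠ Z) :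
    diamF dist Xc ≤ 2 * harmonicR (Xc.card - 1) * avgD dist Y Z := by
  have hP := E.linkClustering (one_le_two.trans hk2) hkn
  obtain ⟨x, hx⟩ := hP.nonempty Xc hXc
  refine csSup_le ⟨_, x, hx, x, hx, rfl⟩ ?_
  rintro r ⟨u, hu, v, hv, rfl⟩
  exact (hP.bounded Xc hXc Y hY Z hZ hYZ).dist_le u hu v hv
end

section
/- Analysis of the instance I^CS: with the point sets A_0, …, A_{t−1} and B_i = A_0 ∪ … ∪ A_i defined below, one has |B_i| = (i+1)! for all 0 ≤ i ≤ t−1, the recurrence avg(A_i, B_{i−1}) = (1 + |B_{i−2}|/|B_{i−1}|) · avg(A_{i−1}, B_{i−2}) holds for all 2 ≤ i ≤ t−1, and there is an execution of average-link on this instance such that for every k with 1 ≤ k ≤ t the k-clustering is A^k = (B_{t−k}, A_{t−k+1}, …, A_{t−1}). -/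
open Finset

/-- `|A_j|`: the group `A_0` is a single point and, for `j ≥ 1`, `A_j` has
`(j+1)! − j!` points. -/
def aCard (j : ℕ) : ℕ := if j = 0 then 1 else (j + 1).factorial - j.factorial

/-- The points of the instance `I^CS`: a point of group `i` (for `i < t`) is a pair
`⟨i, j⟩` with `j < |A_i|`.  The total number of points is `t!`. -/
abbrev PtCS (t : ℕ) := Σ i : Fin t, Fin (aCard i.val)

/-- Distance on the instance `I^CS`: all points of group `i` sit at position `p i` of the
real line, so the distance between a point of group `i` and one of group `j` is
`|p i − p j|`. -/
noncomputable def distCS (t : ℕ) (p : ℕ → ℝ) (u v : PtCS t) : ℝ :=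
  |p u.1.val - p v.1.val|

/-- The group `A_i` of the instance `I^CS`. -/
def Aset (t : ℕ) (i : ℕ) : Finset (PtCS t) :=
  Finset.univ.filter (fun u => u.1.val = i)

/-- `B_i = A_0 ∪ A_1 ∪ ⋯ ∪ A_i`. -/
def Bset (t : ℕ) (i : ℕ) : Finset (PtCS t) :=
  Finset.univ.filter (fun u => u.1.val ≤ i)

/-! ### Cardinalities -/

lemma mem_Aset {t i : ℕ} {u : PtCS t} : u ∈ Aset t i ↔ u.1.val = i := by
  simp [Aset]

lemma mem_Bset {t i : ℕ} {u : PtCS t} : u ∈ Bset t i ↔ u.1.val ≤ i := by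
  simp [Bset]

lemma aCard_pos (j : ℕ) : 0 < aCard j := by
  unfold aCard
  split_ifs with h
  · exact Nat.one_pos
  · exact Nat.sub_pos_of_lt ((Nat.factorial_lt (by omega)).2 (by omega))

lemma card_Aset {t i : ℕ} (hi : i < t) : (Aset t i).card = aCard i := by
  have h : Aset t i
      = Finset.univ.map (Function.Embedding.sigmaMk (β := fun i : Fin t => Fin (aCard i.val))
          ⟨i, hi⟩) := by
    ext ⟨⟨a, ha⟩, b⟩
    simp only [mem_Aset, Finset.mem_map, Finset.mem_univ, true_and,
      Function.Embedding.sigmaMk_apply]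
    constructor
    · rintro rfl
      exact ⟨b, rfl⟩
    · rintro ⟨c, hc⟩
      cases hc
      rfl
  rw [h, Finset.card_map, Finset.card_univ, Fintype.card_fin]

lemma Aset_nonempty {t i : ℕ} (hi : i < t) : (Aset t i).Nonempty :=
  ⟨⟨⟨i, hi⟩, ⟨0, aCard_pos i⟩⟩, mem_Aset.2 rfl⟩

lemma Bset_nonempty {t : ℕ} (ht : 0 < t) (i : ℕ) : (Bset t i).Nonempty :=
  ⟨⟨⟨0, ht⟩, ⟨0, aCard_pos 0⟩⟩, mem_Bset.2 (Nat.zero_le i)⟩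

lemma Bset_zero (t : ℕ) : Bset t 0 = Aset t 0 := by
  ext u
  simp [mem_Aset, mem_Bset]

lemma Bset_succ (t i : ℕ) : Bset t (i + 1) = Bset t i ∪ Aset t (i + 1) := by
  ext u
  simp only [Finset.mem_union, mem_Aset, mem_Bset]
  omega

lemma disjoint_Bset_Aset (t i : ℕ) : Disjoint (Bset t i) (Aset t (i + 1)) := by
  rw [Finset.disjoint_left]
  intro u hu hu'
  rw [mem_Bset] at hu
  rw [mem_Aset] at hu'
  omega

lemma card_Bset {t i : ℕ} (hi : i < t) : (Bset t i).card = (i + 1).factorial := by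
  induction i with
  | zero => rw [Bset_zero, card_Aset hi]; rfl
  | succ i ih =>
    rw [Bset_succ, Finset.card_union_of_disjoint (disjoint_Bset_Aset t i), ih (by omega),
      card_Aset hi, aCard, if_neg (Nat.succ_ne_zero i)]
    exact Nat.add_sub_cancel' (Nat.factorial_le (Nat.le_succ _))

lemma Aset_injOn (t : ℕ) : Set.InjOn (Aset t) (Set.Iio t) := by
  intro i hi j _ h
  obtain ⟨u, hu⟩ := Aset_nonempty hi
  have hu' := hu
  rw [h, mem_Aset] at hu'
  rw [mem_Aset] at hu
  exact hu.symm.trans hu'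

/-! ### Average distances -/

lemma avgD_nonneg {X : Type*} {d : X → X → ℝ} (hd : ∀ x y, 0 ≤ d x y) (A B : Finset X) :
    0 ≤ avgD d A B :=
  div_nonneg (Finset.sum_nonneg fun a _ => Finset.sum_nonneg fun b _ => hd a b) (by positivity)

lemma avgD_comm {X : Type*} {d : X → X → ℝ} (hd : ∀ x y, d x y = d y x) (A B : Finset X) :
    avgD d A B = avgD d B A := by
  unfold avgD
  rw [Finset.sum_comm, mul_comm]
  simp only [hd]

lemma distCS_nonneg (t : ℕ) (p : ℕ → ℝ) (u v : PtCS t) : 0 ≤ distCS t p u v :=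
  abs_nonneg _

lemma distCS_comm (t : ℕ) (p : ℕ → ℝ) (u v : PtCS t) : distCS t p u v = distCS t p v u :=
  abs_sub_comm _ _

lemma avgD_Aset {t i : ℕ} (p : ℕ → ℝ) (hi : i < t) (S : Finset (PtCS t)) :
    avgD (distCS t p) (Aset t i) S = (∑ b ∈ S, |p i - p b.1.val|) / S.card := by
  have hA : ((Aset t i).card : ℝ) ≠ 0 := by
    exact_mod_cast (Finset.card_pos.2 (Aset_nonempty hi)).ne'
  have hsum : ∑ a ∈ Aset t i, ∑ b ∈ S, distCS t p a b
      = (Aset t i).card * ∑ b ∈ S, |p i - p b.1.val| := by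
    rw [← nsmul_eq_mul, ← Finset.sum_const]
    refine Finset.sum_congr rfl fun a ha => ?_
    simp only [distCS, mem_Aset.1 ha]
  rw [avgD, hsum, mul_div_mul_left _ _ hA]

lemma avgD_Aset_Aset {t i j : ℕ} (p : ℕ → ℝ) (hi : i < t) (hj : j < t) :
    avgD (distCS t p) (Aset t i) (Aset t j) = |p i - p j| := by
  have hA : ((Aset t j).card : ℝ) ≠ 0 := by
    exact_mod_cast (Finset.card_pos.2 (Aset_nonempty hj)).ne'
  have hsum : ∑ b ∈ Aset t j, |p i - p b.1.val| = (Aset t j).card * |p i - p j| := by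
    rw [← nsmul_eq_mul, ← Finset.sum_const]
    refine Finset.sum_congr rfl fun b hb => ?_
    rw [mem_Aset.1 hb]
  rw [avgD_Aset p hi, hsum, mul_div_cancel_left₀ _ hA]

lemma avgD_eq_zero {t i : ℕ} (p : ℕ → ℝ) {C C' : Finset (PtCS t)}
    (hC : C ⊆ Aset t i) (hC' : C' ⊆ Aset t i) : avgD (distCS t p) C C' = 0 := by
  have hsum : ∑ a ∈ C, ∑ b ∈ C', distCS t p a b = 0 :=
    Finset.sum_eq_zero fun a ha => Finset.sum_eq_zero fun b hb => by
      rw [distCS, mem_Aset.1 (hC ha), mem_Aset.1 (hC' hb), sub_self, abs_zero]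
  rw [avgD, hsum, zero_div]

/-! ### Positions satisfying the recurrence -/

section Positions

variable {t : ℕ} {p : ℕ → ℝ}

/-- The positions `p` satisfy `p (i + 2) = p (i + 1) + avg(A_{i+1}, B_i)` and
`p 0 ≤ p 1`. -/
structure IsPosCS (t : ℕ) (p : ℕ → ℝ) : Prop where
  zero_le_one : p 0 ≤ p 1
  step : ∀ i, i + 2 < t →
    p (i + 2) = p (i + 1) + avgD (distCS t p) (Aset t (i + 1)) (Bset t i)

lemma IsPosCS.le_succ (h : IsPosCS t p) {i : ℕ} (hi : i + 1 < t) : p i ≤ p (i + 1) := by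
  cases i with
  | zero => exact h.zero_le_one
  | succ i =>
    rw [h.step i hi]
    exact le_add_of_nonneg_right (avgD_nonneg (distCS_nonneg t p) _ _)

lemma IsPosCS.mono (h : IsPosCS t p) {i j : ℕ} (hij : i ≤ j) (hj : j < t) : p i ≤ p j := by
  induction j, hij using Nat.le_induction with
  | base => exact le_rfl
  | succ j _ ih => exact (ih (by omega)).trans (h.le_succ hj)

lemma IsPosCS.avgD_succ (h : IsPosCS t p) {i : ℕ} (hi : i + 2 < t) :
    avgD (distCS t p) (Aset t (i + 2)) (Bset t (i + 1))
      = (1 + ((Bset t i).card : ℝ) / ((Bset t (i + 1)).card : ℝ))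
          * avgD (distCS t p) (Aset t (i + 1)) (Bset t i) := by
  set D := avgD (distCS t p) (Aset t (i + 1)) (Bset t i) with hD
  have hB : ((Bset t i).card : ℝ) ≠ 0 := by
    exact_mod_cast (Finset.card_pos.2 (Bset_nonempty (by omega) i)).ne'
  have hB' : ((Bset t (i + 1)).card : ℝ) ≠ 0 := by
    exact_mod_cast (Finset.card_pos.2 (Bset_nonempty (by omega) (i + 1))).ne'
  have hlow : ∑ b ∈ Bset t i, |p (i + 1) - p b.1.val| = (Bset t i).card * D := by
    rw [hD, avgD_Aset p (by omega), mul_div_cancel₀ _ hB]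
  have htop : ∑ b ∈ Aset t (i + 1), |p (i + 1) - p b.1.val| = 0 :=
    Finset.sum_eq_zero fun b hb => by rw [mem_Aset.1 hb, sub_self, abs_zero]
  have hsplit : ∑ b ∈ Bset t (i + 1), |p (i + 2) - p b.1.val|
      = ∑ b ∈ Bset t (i + 1), (D + |p (i + 1) - p b.1.val|) := by
    refine Finset.sum_congr rfl fun b hb => ?_
    have hb' := h.mono (mem_Bset.1 hb) (by omega)
    have hD0 : 0 ≤ D := avgD_nonneg (distCS_nonneg t p) _ _
    rw [h.step i hi, abs_of_nonneg (by linarith), abs_of_nonneg (by linarith)]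
    ring
  have hsum : ∑ b ∈ Bset t (i + 1), |p (i + 1) - p b.1.val| = (Bset t i).card * D := by
    rw [Bset_succ, Finset.sum_union (disjoint_Bset_Aset t i), hlow, htop, add_zero]
  rw [avgD_Aset p hi, hsplit, Finset.sum_add_distrib, hsum, Finset.sum_const, nsmul_eq_mul]
  field_simp

lemma IsPosCS.avgD_mono (h : IsPosCS t p) {i j : ℕ} (hij : i ≤ j) (hj : j + 1 < t) :
    avgD (distCS t p) (Aset t (i + 1)) (Bset t i)
      ≤ avgD (distCS t p) (Aset t (j + 1)) (Bset t j) := by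
  induction j, hij using Nat.le_induction with
  | base => exact le_rfl
  | succ j _ ih =>
    refine (ih (by omega)).trans ?_
    rw [h.avgD_succ hj]
    refine le_mul_of_one_le_left (avgD_nonneg (distCS_nonneg t p) _ _) ?_
    exact le_add_of_nonneg_right (by positivity)

lemma IsPosCS.avgD_le_Aset_Bset (h : IsPosCS t p) {m j : ℕ} (hmj : m < j) (hj : j < t) :
    avgD (distCS t p) (Aset t (m + 1)) (Bset t m)
      ≤ avgD (distCS t p) (Aset t j) (Bset t m) := by
  rw [avgD_Aset p (by omega), avgD_Aset p hj]
  gcongr with b hb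
  · have h₁ := h.mono (Nat.le_succ_of_le (mem_Bset.1 hb)) (by omega)
    linarith
  · exact h.mono hmj hj

lemma IsPosCS.avgD_le_Aset_Aset_of_lt (h : IsPosCS t p) {m i j : ℕ} (hmi : m < i)
    (hij : i < j) (hj : j < t) :
    avgD (distCS t p) (Aset t (m + 1)) (Bset t m)
      ≤ avgD (distCS t p) (Aset t i) (Aset t j) := by
  obtain ⟨i, rfl⟩ : ∃ i', i = i' + 1 := ⟨i - 1, by omega⟩
  have hD := h.avgD_mono (show m ≤ i by omega) (show i + 1 < t by omega)
  have hp := h.step i (by omega)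
  have hj' := h.mono (show i + 2 ≤ j from hij) hj
  rw [avgD_Aset_Aset p (by omega) hj, abs_sub_comm]
  exact le_trans (by linarith) (le_abs_self _)

end Positions

/-! ### Merging the groups -/

/-- The clustering `(B_m, A_{m+1}, …, A_{t−1})`. -/
def chainPart (t m : ℕ) : Finset (Finset (PtCS t)) :=
  insert (Bset t m) ((Finset.Ico (m + 1) t).image fun i => Aset t i)

lemma mem_chainPart {t m : ℕ} {C : Finset (PtCS t)} :
    C ∈ chainPart t m ↔ C = Bset t m ∨ ∃ i, m < i ∧ i < t ∧ Aset t i = C := by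
  simp only [chainPart, Finset.mem_insert, Finset.mem_image, Finset.mem_Ico, and_assoc,
    Nat.succ_le_iff]

lemma Bset_ne_Aset {t m i : ℕ} (hi : m < i) (hit : i < t) : Bset t m ≠ Aset t i := by
  intro h
  obtain ⟨u, hu⟩ := Bset_nonempty (by omega : 0 < t) m
  have hu' := hu
  rw [h, mem_Aset] at hu'
  rw [mem_Bset] at hu
  omega

lemma chainPart_succ {t m : ℕ} (hm : m + 1 < t) :
    chainPart t (m + 1) = insert (Bset t m ∪ Aset t (m + 1))
      (((chainPart t m).erase (Bset t m)).erase (Aset t (m + 1))) := by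
  ext C
  rw [← Bset_succ, Finset.mem_insert, Finset.mem_erase, Finset.mem_erase, mem_chainPart,
    mem_chainPart]
  refine or_congr_right ⟨?_, ?_⟩
  · rintro ⟨i, hi, hit, rfl⟩
    refine ⟨fun hA => ?_, (Bset_ne_Aset (by omega) hit).symm, Or.inr ⟨i, by omega, hit, rfl⟩⟩
    have := Aset_injOn t hit hm hA
    omega
  · rintro ⟨hA, hB, rfl | ⟨i, hi, hit, rfl⟩⟩
    · exact absurd rfl hB
    · refine ⟨i, lt_of_le_of_ne hi ?_, hit, rfl⟩
      rintro rfl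
      exact hA rfl

lemma IsPosCS.avgD_le_of_mem_chainPart {t m : ℕ} {p : ℕ → ℝ} (h : IsPosCS t p)
    {C C' : Finset (PtCS t)} (hC : C ∈ chainPart t m) (hC' : C' ∈ chainPart t m)
    (hne : C ≠ C') :
    avgD (distCS t p) (Bset t m) (Aset t (m + 1)) ≤ avgD (distCS t p) C C' := by
  have hcomm := avgD_comm (distCS_comm t p)
  rw [hcomm]
  rcases mem_chainPart.1 hC with rfl | ⟨i, hi, hit, rfl⟩ <;>
    rcases mem_chainPart.1 hC' with rfl | ⟨j, hj, hjt, rfl⟩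
  · exact absurd rfl hne
  · rw [hcomm (Bset t m)]
    exact h.avgD_le_Aset_Bset hj hjt
  · exact h.avgD_le_Aset_Bset hi hit
  · rcases lt_trichotomy i j with hij | rfl | hij
    · exact h.avgD_le_Aset_Aset_of_lt hi hij hjt
    · exact absurd rfl hne
    · rw [hcomm (Aset t i)]
      exact h.avgD_le_Aset_Aset_of_lt hj hij hit

/-! ### Merging within the groups -/

/-- `P` partitions the points into nonempty clusters, each contained in one group. -/
structure IsGroupRefinement (t : ℕ) (P : Finset (Finset (PtCS t))) : Prop where
  nonempty : ∀ C ∈ P, C.Nonempty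
  cover : ∀ u : PtCS t, ∃ C ∈ P, u ∈ C
  unique : ∀ C ∈ P, ∀ C' ∈ P, ∀ u, u ∈ C → u ∈ C' → C = C'
  group : ∀ C ∈ P, ∃ i < t, C ⊆ Aset t i

/-- `Q` arises from `P` by merging two distinct clusters at minimum average distance. -/
def IsAvgLinkStep {X : Type*} [DecidableEq X] (d : X → X → ℝ) (P Q : Finset (Finset X)) : Prop :=
  ∃ A ∈ P, ∃ B ∈ P, A ≠ B ∧ (∀ A' ∈ P, ∀ B' ∈ P, A' ≠ B' → avgD d A B ≤ avgD d A' B') ∧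
    Q = insert (A ∪ B) ((P.erase A).erase B)

lemma isGroupRefinement_singletons (t : ℕ) :
    IsGroupRefinement t (Finset.univ.image fun u : PtCS t => ({u} : Finset (PtCS t))) where
  nonempty C hC := by
    obtain ⟨u, -, rfl⟩ := Finset.mem_image.1 hC
    exact Finset.singleton_nonempty u
  cover u := ⟨{u}, Finset.mem_image_of_mem _ (Finset.mem_univ u), Finset.mem_singleton_self u⟩
  unique C hC C' hC' u hu hu' := by
    obtain ⟨v, -, rfl⟩ := Finset.mem_image.1 hC
    obtain ⟨w, -, rfl⟩ := Finset.mem_image.1 hC'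
    rw [← Finset.mem_singleton.1 hu, ← Finset.mem_singleton.1 hu']
  group C hC := by
    obtain ⟨u, -, rfl⟩ := Finset.mem_image.1 hC
    exact ⟨u.1.val, u.1.isLt, Finset.singleton_subset_iff.2 (mem_Aset.2 rfl)⟩

namespace IsGroupRefinement

variable {t : ℕ} {P : Finset (Finset (PtCS t))}

lemma exists_subset_Aset (h : IsGroupRefinement t P) {i : ℕ} (hi : i < t) :
    ∃ C ∈ P, C ⊆ Aset t i := by
  obtain ⟨u, hu⟩ := Aset_nonempty hi
  obtain ⟨C, hC, huC⟩ := h.cover u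
  obtain ⟨j, _, hCj⟩ := h.group C hC
  have hij : i = j := (mem_Aset.1 hu).symm.trans (mem_Aset.1 (hCj huC))
  exact ⟨C, hC, hij ▸ hCj⟩

lemma eq_chainPart (h : IsGroupRefinement t P) (ht : 0 < t) (hP : P.card = t) :
    P = chainPart t 0 := by
  choose! f hfP hfA using fun i (hi : i < t) => h.exists_subset_Aset hi
  have hf : Set.InjOn f (Finset.range t) := by
    intro i hi j hj hij
    rw [Finset.coe_range] at hi hj
    obtain ⟨u, hu⟩ := h.nonempty _ (hfP i hi)
    exact (mem_Aset.1 (hfA i hi hu)).symm.trans (mem_Aset.1 (hfA j hj (hij ▸ hu)))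
  have hfim : (Finset.range t).image f = P := by
    refine Finset.eq_of_subset_of_card_le ?_ ?_
    · exact Finset.image_subset_iff.2 fun i hi => hfP i (Finset.mem_range.1 hi)
    · rw [Finset.card_image_of_injOn hf, Finset.card_range, hP]
  have hfeq : ∀ i < t, f i = Aset t i := by
    refine fun i hi => (hfA i hi).antisymm fun u hu => ?_
    obtain ⟨C, hC, huC⟩ := h.cover u
    rw [← hfim] at hC
    obtain ⟨j, hj, rfl⟩ := Finset.mem_image.1 hC
    have hij : j = i :=
      (mem_Aset.1 (hfA j (Finset.mem_range.1 hj) huC)).symm.trans (mem_Aset.1 hu)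
    exact hij ▸ huC
  rw [← hfim]
  ext C
  rw [mem_chainPart, Finset.mem_image, Bset_zero]
  constructor
  · rintro ⟨i, hi, rfl⟩
    rw [Finset.mem_range] at hi
    rw [hfeq i hi]
    rcases Nat.eq_zero_or_pos i with rfl | hi0
    · exact Or.inl rfl
    · exact Or.inr ⟨i, hi0, hi, rfl⟩
  · rintro (rfl | ⟨i, -, hi, rfl⟩)
    · exact ⟨0, Finset.mem_range.2 ht, hfeq 0 ht⟩
    · exact ⟨i, Finset.mem_range.2 hi, hfeq i hi⟩

lemma exists_pair (h : IsGroupRefinement t P) (hP : t < P.card) :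
    ∃ A ∈ P, ∃ B ∈ P, A ≠ B ∧ ∃ i < t, A ⊆ Aset t i ∧ B ⊆ Aset t i := by
  choose! g hgt hgA using h.group
  obtain ⟨A, hA, B, hB, hne, hg⟩ := Finset.exists_ne_map_eq_of_card_lt_of_maps_to
    (t := Finset.range t) (f := g) (by rwa [Finset.card_range])
    (fun C hC => Finset.mem_range.2 (hgt C hC))
  exact ⟨A, hA, B, hB, hne, g A, hgt A hA, hgA A hA, hg ▸ hgA B hB⟩

lemma merge (h : IsGroupRefinement t P) {A B : Finset (PtCS t)} (hA : A ∈ P) (hB : B ∈ P)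
    {i : ℕ} (hi : i < t) (hAi : A ⊆ Aset t i) (hBi : B ⊆ Aset t i) :
    IsGroupRefinement t (insert (A ∪ B) ((P.erase A).erase B)) where
  nonempty C hC := by
    rcases Finset.mem_insert.1 hC with rfl | hC
    · exact (h.nonempty A hA).mono Finset.subset_union_left
    · exact h.nonempty C (Finset.mem_of_mem_erase (Finset.mem_of_mem_erase hC))
  cover u := by
    obtain ⟨C, hC, hu⟩ := h.cover u
    by_cases hCA : C = A
    · exact ⟨A ∪ B, by simp, by simp [← hCA, hu]⟩
    by_cases hCB : C = B
    · exact ⟨A ∪ B, by simp, by simp [← hCB, hu]⟩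
    exact ⟨C, by simp [hCA, hCB, hC], hu⟩
  unique C hC C' hC' u hu hu' := by
    have key : ∀ C ∈ (P.erase A).erase B, u ∈ C → u ∉ A ∪ B := by
      intro C hC hu hu'
      simp only [Finset.mem_erase] at hC
      rcases Finset.mem_union.1 hu' with hu' | hu'
      · exact hC.2.1 (h.unique C hC.2.2 A hA u hu hu')
      · exact hC.1 (h.unique C hC.2.2 B hB u hu hu')
    rcases Finset.mem_insert.1 hC with rfl | hC <;> rcases Finset.mem_insert.1 hC' with rfl | hC'
    · rfl
    · exact absurd hu (key C' hC' hu')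
    · exact absurd hu' (key C hC hu)
    · exact h.unique C (Finset.mem_of_mem_erase (Finset.mem_of_mem_erase hC)) C'
        (Finset.mem_of_mem_erase (Finset.mem_of_mem_erase hC')) u hu hu'
  group C hC := by
    rcases Finset.mem_insert.1 hC with rfl | hC
    · exact ⟨i, hi, Finset.union_subset hAi hBi⟩
    · exact h.group C (Finset.mem_of_mem_erase (Finset.mem_of_mem_erase hC))

lemma card_merge (h : IsGroupRefinement t P) {A B : Finset (PtCS t)} (hA : A ∈ P) (hB : B ∈ P)
    (hne : A ≠ B) : (insert (A ∪ B) ((P.erase A).erase B)).card + 1 = P.card := by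
  have hnot : A ∪ B ∉ (P.erase A).erase B := by
    intro hmem
    simp only [Finset.mem_erase] at hmem
    obtain ⟨u, hu⟩ := h.nonempty A hA
    exact hmem.2.1 (h.unique _ hmem.2.2 A hA u (Finset.mem_union_left _ hu) hu)
  rw [Finset.card_insert_of_notMem hnot,
    Finset.card_erase_add_one (Finset.mem_erase.2 ⟨hne.symm, hB⟩), Finset.card_erase_add_one hA]

lemma exists_step (h : IsGroupRefinement t P) (p : ℕ → ℝ) (hP : t < P.card) :
    ∃ Q, IsGroupRefinement t Q ∧ Q.card + 1 = P.card ∧ IsAvgLinkStep (distCS t p) P Q := by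
  obtain ⟨A, hA, B, hB, hne, i, hi, hAi, hBi⟩ := h.exists_pair hP
  refine ⟨_, h.merge hA hB hi hAi hBi, h.card_merge hA hB hne, A, hA, B, hB, hne, ?_, rfl⟩
  intro A' _ B' _ _
  rw [avgD_eq_zero p hAi hBi]
  exact avgD_nonneg (distCS_nonneg t p) A' B'

lemma exists_run {p : ℕ → ℝ} (hpos : IsPosCS t p) (ht : 0 < t) {n : ℕ} (hn : t ≤ n)
    (h : IsGroupRefinement t P) (hP : P.card = n) :
    ∃ part : ℕ → Finset (Finset (PtCS t)), part n = P ∧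
      (∀ k, 1 ≤ k → k < n → IsAvgLinkStep (distCS t p) (part (k + 1)) (part k)) ∧
      ∀ k, 1 ≤ k → k ≤ t → part k = chainPart t (t - k) := by
  induction n, hn using Nat.le_induction generalizing P with
  | base =>
    refine ⟨fun k => chainPart t (t - k), ?_, fun k hk hkt => ?_, fun _ _ _ => rfl⟩
    · simp only [Nat.sub_self, h.eq_chainPart ht hP]
    · obtain ⟨m, hm⟩ : ∃ m, t = m + (k + 1) := ⟨t - (k + 1), by omega⟩
      have h₁ : t - (k + 1) = m := by omega
      have h₂ : t - k = m + 1 := by omega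
      simp only [h₁, h₂]
      exact ⟨Bset t m, mem_chainPart.2 (Or.inl rfl), Aset t (m + 1),
        mem_chainPart.2 (Or.inr ⟨m + 1, by omega, by omega, rfl⟩),
        Bset_ne_Aset (by omega) (by omega),
        fun C hC C' hC' hne => hpos.avgD_le_of_mem_chainPart hC hC' hne,
        chainPart_succ (by omega)⟩
  | succ n hn ih =>
    obtain ⟨Q, hQ, hcard, hstep⟩ := h.exists_step p (by omega)
    obtain ⟨part, hpn, hpstep, hpchain⟩ := ih hQ (by omega)
    refine ⟨Function.update part (n + 1) P, Function.update_self _ _ _, fun k hk hkn => ?_,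
      fun k hk hkt => ?_⟩
    · rw [Function.update_of_ne (show k ≠ n + 1 by omega)]
      rcases Nat.lt_succ_iff_lt_or_eq.1 hkn with hlt | rfl
      · rw [Function.update_of_ne (show k + 1 ≠ n + 1 by omega)]
        exact hpstep k hk hlt
      · rw [Function.update_self, hpn]
        exact hstep
    · rw [Function.update_of_ne (show k ≠ n + 1 by omega)]
      exact hpchain k hk hkt

end IsGroupRefinement

lemma le_card_PtCS (t : ℕ) : t ≤ Fintype.card (PtCS t) := by
  have hinj : Function.Injective
      (fun i : Fin t => (⟨i, ⟨0, aCard_pos i.val⟩⟩ : PtCS t)) :=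
    fun i j hij => congrArg Sigma.fst hij
  simpa using Fintype.card_le_of_injective _ hinj

/-- Analysis of the instance `I^CS` (positions `p 0 = 0`, `p 1 = 1`, and
`p i = p (i−1) + avg(A_{i−1}, B_{i−2})` for `2 ≤ i ≤ t−1`):
`|B_i| = (i+1)!` for `i ≤ t−1`; the recurrence
`avg(A_i, B_{i−1}) = (1 + |B_{i−2}|/|B_{i−1}|) · avg(A_{i−1}, B_{i−2})` holds for
`2 ≤ i ≤ t−1`; and some execution of average-link produces, for every `1 ≤ k ≤ t`, the
`k`-clustering `(B_{t−k}, A_{t−k+1}, …, A_{t−1})`. -/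
theorem instanceICS_analysis (t : ℕ) (ht : 2 ≤ t) (p : ℕ → ℝ)
    (hp0 : p 0 = 0) (hp1 : p 1 = 1)
    (hrec : ∀ i, 2 ≤ i → i ≤ t - 1 →
      p i = p (i - 1) + avgD (distCS t p) (Aset t (i - 1)) (Bset t (i - 2))) :
    (∀ i, i ≤ t - 1 → (Bset t i).card = (i + 1).factorial) ∧
    (∀ i, 2 ≤ i → i ≤ t - 1 →
      avgD (distCS t p) (Aset t i) (Bset t (i - 1))
        = (1 + ((Bset t (i - 2)).card : ℝ) / ((Bset t (i - 1)).card : ℝ))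
            * avgD (distCS t p) (Aset t (i - 1)) (Bset t (i - 2))) ∧
    (∃ E : AvgLinkExec (PtCS t) (distCS t p), ∀ k, 1 ≤ k → k ≤ t →
      E.part k
        = insert (Bset t (t - k)) ((Finset.Ico (t - k + 1) t).image (fun i => Aset t i))) := by
  have hpos : IsPosCS t p :=
    ⟨by rw [hp0, hp1]; exact zero_le_one, fun i hi => hrec (i + 2) (by omega) (by omega)⟩
  refine ⟨fun i hi => card_Bset (by omega), fun i hi hit => ?_, ?_⟩
  · obtain ⟨j, rfl⟩ : ∃ j, i = j + 2 := ⟨i - 2, by omega⟩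
    exact hpos.avgD_succ (by omega)
  · obtain ⟨part, hinit, hstep, hchain⟩ :=
      IsGroupRefinement.exists_run hpos (by omega) (le_card_PtCS t)
        (isGroupRefinement_singletons t)
        (Finset.card_image_of_injective _ Finset.singleton_injective)
    exact ⟨⟨part, hinit, hstep⟩, hchain⟩
end
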